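/- Let (X, ρ) be a Polish metric space and σ > 0, and suppose P is a probability measure on X such that every 1-Lipschitz function f : X → ℝ is σ-subgaussian under P. Then for any probability measure Q on X, W₁(Q,P) ≤ sqrt(2σ² KL(Q‖P)). Consequently, if a loss ℓ(·,z) is L-Lipschitz under ρ and σ-subgaussian under P_W for all z, the single-letter Wasserstein generalization bound implies |E[gen(W,S)]| ≤ (1/n)Σᵢ sqrt(2σ² I(W;Z_i)) after Jensen's inequality. -/

import Mathlib

open MeasureTheory ProbabilityTheory
open scoped ENNReal NNReal

noncomputable section

/-- The set of couplings of two measures. -/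
def couplings {X : Type*} [MeasurableSpace X] (P Q : Measure X) : Set (Measure (X × X)) :=
  {μ | μ.map Prod.fst = P ∧ μ.map Prod.snd = Q}

/-- Wasserstein distance of order 1. -/
def W1 {X : Type*} [MeasurableSpace X] [PseudoEMetricSpace X] (P Q : Measure X) : ℝ :=
  (⨅ μ ∈ couplings P Q, ∫⁻ p : X × X, edist p.1 p.2 ∂μ).toReal

variable {Z W : Type*} [MeasurableSpace Z] [MeasurableSpace W]

/-- The law of an i.i.d. dataset of `n` samples from `PZ`. -/
def Pn (PZ : Measure Z) (n : ℕ) : Measure (Fin n → Z) := Measure.pi fun _ => PZ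

/-- Marginal law of the hypothesis `P_W`. -/
def hypLaw (PZ : Measure Z) {n : ℕ} (A : Kernel (Fin n → Z) W) : Measure W :=
  (Pn PZ n).bind fun s => A s

/-- Conditional law `P_{W | Z_i = z}` of the hypothesis given the `i`-th sample. -/
def condLaw (PZ : Measure Z) {n : ℕ} (A : Kernel (Fin n → Z) W) (i : Fin n) (z : Z) :
    Measure W :=
  (Pn PZ n).bind fun s => A (Function.update s i z)

/-- Generalization error `gen(w,s) = E_{Z∼PZ}[ℓ(w,Z)] − (1/n) Σᵢ ℓ(w,sᵢ)`. -/
def gen (PZ : Measure Z) {n : ℕ} (ℓ : W → Z → ℝ) (w : W) (s : Fin n → Z) : ℝ :=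
  (∫ z, ℓ w z ∂PZ) - (1 / (n : ℝ)) * ∑ i, ℓ w (s i)

/-- Expected generalization error `E[gen(W,S)]` under the joint law `P_{W,S}`. -/
def expGen (PZ : Measure Z) {n : ℕ} (A : Kernel (Fin n → Z) W) (ℓ : W → Z → ℝ) : ℝ :=
  ∫ s, ∫ w, gen PZ ℓ w s ∂(A s) ∂(Pn PZ n)

/-- Kullback–Leibler divergence `∫ log (dP/dQ) dP`. -/
def klDiv {X : Type*} [MeasurableSpace X] (P Q : Measure X) : ℝ :=
  ∫ x, Real.log ((P.rnDeriv Q x).toReal) ∂P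

def dualSet {ι : Type*} [Fintype ι] (q p : ι → ℝ) (h : ι × ι → ℝ) : Set ℝ :=
  {v | ∃ φ ψ : ι → ℝ, (∀ i j, h (i, j) ≤ φ i + ψ j) ∧ v = ∑ i, φ i * q i + ∑ j, ψ j * p j}

lemma fin_dual {ι : Type*} [Fintype ι] (q p : ι → ℝ) (hq : ∀ i, 0 ≤ q i) (hp : ∀ i, 0 ≤ p i)
    (hq1 : ∑ i, q i = 1) (hp1 : ∑ i, p i = 1) (c : ι → ι → ℝ) (ε : ℝ) (hε : 0 < ε) :
    ∃ π : ι → ι → ℝ, (∀ i j, 0 ≤ π i j) ∧ (∀ i, ∑ j, π i j = q i) ∧ (∀ j, ∑ i, π i j = p j) ∧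
      ∃ φ ψ : ι → ℝ, (∀ i j, φ i + ψ j ≤ c i j) ∧
        ∑ i, ∑ j, π i j * c i j ≤ ∑ i, φ i * q i + ∑ j, ψ j * p j + ε := by
  classical
  set N : (ι × ι → ℝ) → ℝ := fun h => sInf (dualSet q p h) with hN
  have hne : ∀ h, (dualSet q p h).Nonempty := by
    intro h
    refine ⟨_, fun i => ∑ j, |h (i, j)|, fun _ => 0, ?_, rfl⟩
    intro i j
    have := Finset.single_le_sum (f := fun j => |h (i, j)|) (fun j _ => abs_nonneg _)
      (Finset.mem_univ j)
    have h2 := le_abs_self (h (i, j))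
    linarith
  have hbdd : ∀ h, BddBelow (dualSet q p h) := by
    intro h
    refine ⟨∑ i, ∑ j, h (i, j) * (q i * p j), ?_⟩
    rintro v ⟨φ, ψ, hh, rfl⟩
    have e1 : ∑ i, φ i * q i = ∑ i, ∑ j, φ i * (q i * p j) := by
      refine Finset.sum_congr rfl fun i _ => ?_
      rw [← Finset.mul_sum, ← Finset.mul_sum, hp1, mul_one]
    have e2 : ∑ j, ψ j * p j = ∑ i, ∑ j, ψ j * (q i * p j) := by
      rw [Finset.sum_comm]
      refine Finset.sum_congr rfl fun j _ => ?_
      rw [← Finset.mul_sum, ← Finset.sum_mul, hq1, one_mul]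
    rw [e1, e2, ← Finset.sum_add_distrib]
    refine Finset.sum_le_sum fun i _ => ?_
    rw [← Finset.sum_add_distrib]
    refine Finset.sum_le_sum fun j _ => ?_
    rw [← add_mul]
    exact mul_le_mul_of_nonneg_right (hh i j) (mul_nonneg (hq i) (hp j))
  have hle : ∀ (h : ι × ι → ℝ) (φ ψ : ι → ℝ), (∀ i j, h (i, j) ≤ φ i + ψ j) →
      N h ≤ ∑ i, φ i * q i + ∑ j, ψ j * p j := by
    intro h φ ψ hh
    exact csInf_le (hbdd h) ⟨φ, ψ, hh, rfl⟩
  have hom1 : ∀ a : ℝ, 0 < a → ∀ x, N (a • x) ≤ a * N x := by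
    intro a ha x
    rw [← div_le_iff₀' ha]
    refine le_csInf (hne x) ?_
    rintro v ⟨φ, ψ, hh, rfl⟩
    rw [div_le_iff₀' ha]
    refine (hle (a • x) (fun i => a * φ i) (fun j => a * ψ j) ?_).trans (le_of_eq ?_)
    · intro i j
      have := mul_le_mul_of_nonneg_left (hh i j) ha.le
      simp only [Pi.smul_apply, smul_eq_mul]
      linarith
    · simp only [mul_add, Finset.mul_sum, mul_assoc]
  have N_hom : ∀ a : ℝ, 0 < a → ∀ x, N (a • x) = a * N x := by
    intro a ha x
    refine le_antisymm (hom1 a ha x) ?_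
    have := hom1 a⁻¹ (inv_pos.2 ha) (a • x)
    rw [smul_smul, inv_mul_cancel₀ ha.ne', one_smul] at this
    rwa [le_inv_mul_iff₀ ha] at this
  have N_add : ∀ x y, N (x + y) ≤ N x + N y := by
    intro x y
    rw [← sub_le_iff_le_add]
    refine le_csInf (hne x) ?_
    rintro v ⟨φ, ψ, hh, rfl⟩
    rw [sub_le_comm]
    refine le_csInf (hne y) ?_
    rintro v ⟨φ', ψ', hh', rfl⟩
    have := hle (x + y) (fun i => φ i + φ' i) (fun j => ψ j + ψ' j) (by
      intro i j
      have := hh i j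
      have := hh' i j
      simp only [Pi.add_apply]
      linarith)
    simp only [add_mul, Finset.sum_add_distrib] at this
    linarith
  have N_0 : N 0 = 0 := by
    have := N_hom 2 (by norm_num) 0
    rw [smul_zero] at this
    linarith
  set c' : ι × ι → ℝ := fun ij => -c ij.1 ij.2 with hc'
  obtain ⟨g, hg1, hg2⟩ := exists_extension_of_le_sublinear
    (LinearPMap.mkSpanSingleton' (σ := RingHom.id ℝ) c' (N c') (by
      intro a ha
      by_cases h0 : a = 0
      · simp [h0]
      · have : c' = 0 := (smul_eq_zero.1 ha).resolve_left h0
        rw [this, N_0, smul_zero])) N N_hom N_add (by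
      rintro ⟨x, hx⟩
      obtain ⟨a, rfl⟩ := Submodule.mem_span_singleton.1 hx
      rw [LinearPMap.mkSpanSingleton'_apply]
      simp only [RingHom.id_apply, smul_eq_mul]
      rcases lt_trichotomy a 0 with h | h | h
      · have h1 := N_add (a • c') ((-a) • c')
        rw [← add_smul, add_neg_cancel, zero_smul, N_0, N_hom (-a) (by linarith)] at h1
        linarith
      · simp [h, N_0]
      · rw [N_hom a h])
  have hgc : g c' = N c' := by
    have := hg1 ⟨c', Submodule.mem_span_singleton_self c'⟩
    exact this.trans (LinearPMap.mkSpanSingleton'_apply_self _ _ _ _)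
  set π : ι → ι → ℝ := fun i j => g (Pi.single (i, j) 1) with hπ
  have hgsum : ∀ h : ι × ι → ℝ, g h = ∑ i, ∑ j, h (i, j) * π i j := by
    intro h
    have : h = ∑ ij : ι × ι, h ij • (Pi.single ij (1 : ℝ) : ι × ι → ℝ) := by
      ext k
      simp [Finset.sum_apply, Pi.single_apply]
    conv_lhs => rw [this]
    rw [map_sum, Fintype.sum_prod_type]
    simp [hπ]
  have marg1 : ∀ φ : ι → ℝ, g (fun ij => φ ij.1) ≤ ∑ i, φ i * q i := by
    intro φ
    refine (hg2 _).trans ((hle _ φ 0 (by simp)).trans (by simp))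
  have marg2 : ∀ φ : ι → ℝ, g (fun ij => φ ij.2) ≤ ∑ i, φ i * p i := by
    intro φ
    refine (hg2 _).trans ((hle _ 0 φ (by simp)).trans (by simp))
  refine ⟨π, ?_, ?_, ?_, ?_⟩
  · intro i j
    have h1 := (hg2 (-(Pi.single (i, j) 1))).trans (hle _ 0 0 (by
      intro a b
      by_cases h : (a, b) = (i, j) <;> simp [h]))
    rw [map_neg] at h1
    simp at h1
    exact h1
  · intro i
    have h1 := marg1 (Pi.single i 1)
    have h2 := marg1 (-Pi.single i 1)
    rw [hgsum] at h1 h2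
    simp [Pi.single_apply] at h1 h2
    linarith
  · intro j
    have h1 := marg2 (Pi.single j 1)
    have h2 := marg2 (-Pi.single j 1)
    rw [hgsum] at h1 h2
    simp [Pi.single_apply] at h1 h2
    linarith
  · obtain ⟨v, ⟨φ, ψ, hh, rfl⟩, hv⟩ := exists_lt_of_csInf_lt (hne c')
      (show sInf (dualSet q p c') < N c' + ε by simp only [hN]; linarith)
    refine ⟨-φ, -ψ, ?_, ?_⟩
    · intro i j
      have := hh i j
      simp only [hc'] at this
      simp only [Pi.neg_apply]
      linarith
    · rw [← hgc, hgsum] at hv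
      simp only [hc', neg_mul, Finset.sum_neg_distrib] at hv
      simp only [Pi.neg_apply, neg_mul, Finset.sum_neg_distrib]
      simp only [mul_comm (π _ _)]
      linarith

lemma coupling_of_fin {X : Type*} [MeasurableSpace X] (Q P : Measure X)
    [IsProbabilityMeasure Q] [IsProbabilityMeasure P] {ι : Type*} [Fintype ι]
    [MeasurableSpace ι] [MeasurableSingletonClass ι] (T : X → ι) (hT : Measurable T)
    (a : ι → ι → ℝ≥0∞) (ha1 : ∀ i, ∑ j, a i j = Q (T ⁻¹' {i}))
    (ha2 : ∀ j, ∑ i, a i j = P (T ⁻¹' {j})) :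
    ∃ μ ∈ couplings Q P, ∀ g : ι → ι → ℝ≥0∞,
      ∫⁻ p : X × X, g (T p.1) (T p.2) ∂μ ≤ ∑ i, ∑ j, a i j * g i j := by
  classical
  have hms : ∀ i, MeasurableSet (T ⁻¹' {i}) := fun i => hT (measurableSet_singleton i)
  have e1 : ∀ i j, a i j * (P[|T ⁻¹' {j}]) Set.univ = a i j := by
    intro i j
    by_cases h : P (T ⁻¹' {j}) = 0
    · have : a i j = 0 := by
        have h2 := ha2 j
        rw [h] at h2
        exact (Finset.sum_eq_zero_iff.1 h2) i (Finset.mem_univ i)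
      rw [this, zero_mul]
    · have := cond_isProbabilityMeasure h
      rw [measure_univ, mul_one]
  have e2 : ∀ i j, a i j * (Q[|T ⁻¹' {i}]) Set.univ = a i j := by
    intro i j
    by_cases h : Q (T ⁻¹' {i}) = 0
    · have : a i j = 0 := by
        have h2 := ha1 i
        rw [h] at h2
        exact (Finset.sum_eq_zero_iff.1 h2) j (Finset.mem_univ j)
      rw [this, zero_mul]
    · have := cond_isProbabilityMeasure h
      rw [measure_univ, mul_one]
  refine ⟨∑ i, ∑ j, a i j • (Q[|T ⁻¹' {i}]).prod (P[|T ⁻¹' {j}]), ⟨?_, ?_⟩, ?_⟩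
  · ext B hB
    rw [Measure.map_apply measurable_fst hB]
    have : (Prod.fst ⁻¹' B : Set (X × X)) = B ×ˢ Set.univ := by ext; simp
    rw [this]
    simp only [Measure.coe_finsetSum, Finset.sum_apply, Measure.smul_apply, smul_eq_mul,
      Measure.prod_prod]
    conv_rhs => rw [← sum_meas_smul_cond_fiber hT Q]
    simp only [Measure.coe_finsetSum, Finset.sum_apply, Measure.smul_apply, smul_eq_mul]
    refine Finset.sum_congr rfl fun i _ => ?_
    rw [← ha1 i, Finset.sum_mul]
    refine Finset.sum_congr rfl fun j _ => ?_
    rw [mul_left_comm, e1, mul_comm]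
  · ext B hB
    rw [Measure.map_apply measurable_snd hB]
    have : (Prod.snd ⁻¹' B : Set (X × X)) = Set.univ ×ˢ B := by ext; simp
    rw [this]
    simp only [Measure.coe_finsetSum, Finset.sum_apply, Measure.smul_apply, smul_eq_mul,
      Measure.prod_prod]
    conv_rhs => rw [← sum_meas_smul_cond_fiber hT P]
    simp only [Measure.coe_finsetSum, Finset.sum_apply, Measure.smul_apply, smul_eq_mul]
    rw [Finset.sum_comm]
    refine Finset.sum_congr rfl fun j _ => ?_
    rw [← ha2 j, Finset.sum_mul]
    refine Finset.sum_congr rfl fun i _ => ?_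
    rw [← mul_assoc, e2]
  · intro g
    simp only [lintegral_finsetSum_measure, lintegral_smul_measure, smul_eq_mul]
    refine Finset.sum_le_sum fun i _ => Finset.sum_le_sum fun j _ => ?_
    have hae1 : ∀ᵐ x ∂(Q[|T ⁻¹' {i}]), T x = i := by
      have := ae_cond_mem (μ := Q) (hms i)
      simpa using this
    have hae2 : ∀ᵐ x ∂(P[|T ⁻¹' {j}]), T x = j := by
      have := ae_cond_mem (μ := P) (hms j)
      simpa using this
    have hae : ∀ᵐ p : X × X ∂((Q[|T ⁻¹' {i}]).prod (P[|T ⁻¹' {j}])),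
        g (T p.1) (T p.2) = g i j := by
      filter_upwards [Measure.quasiMeasurePreserving_fst.ae hae1,
        Measure.quasiMeasurePreserving_snd.ae hae2] with p h1 h2
      rw [h1, h2]
    rw [lintegral_congr_ae hae, lintegral_const]
    rw [← Set.univ_prod_univ, Measure.prod_prod]
    rw [mul_left_comm, mul_comm (g i j), ← mul_assoc, e2]
    rw [e1]

lemma integral_comp_fin {X ι : Type*} [MeasurableSpace X] (Q : Measure X) [IsProbabilityMeasure Q]
    [Fintype ι] [MeasurableSpace ι] [MeasurableSingletonClass ι] (T : X → ι) (hT : Measurable T)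
    (h : ι → ℝ) : ∫ x, h (T x) ∂Q = ∑ i, h i * Q.real (T ⁻¹' {i}) := by
  have := Measure.isProbabilityMeasure_map (μ := Q) hT.aemeasurable
  have h1 : ∫ i, h i ∂(Q.map T) = ∫ x, h (T x) ∂Q :=
    integral_map hT.aemeasurable (Measurable.of_discrete).aestronglyMeasurable
  rw [← h1, integral_fintype (Integrable.of_finite)]
  refine Finset.sum_congr rfl fun i _ => ?_
  rw [smul_eq_mul, mul_comm, map_measureReal_apply hT (measurableSet_singleton i)]

lemma lipschitz_integrable {X : Type*} [MetricSpace X] [MeasurableSpace X] [BorelSpace X]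
    (Q : Measure X) [IsProbabilityMeasure Q] (x0 : X)
    (hQ : Integrable (fun x => dist x x0) Q) (F : X → ℝ) (hF : LipschitzWith 1 F) :
    Integrable F Q := by
  refine Integrable.mono' (hQ.add (integrable_const |F x0|)) ?_ ?_
  · exact hF.continuous.measurable.aestronglyMeasurable
  · refine Filter.Eventually.of_forall fun x => ?_
    have h1 := hF.dist_le_mul x x0
    rw [Real.dist_eq] at h1
    simp only [NNReal.coe_one, one_mul] at h1
    rw [Real.norm_eq_abs]
    have := abs_add_le (F x - F x0) (F x0)
    simp only [sub_add_cancel] at this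
    simp only [Pi.add_apply]
    linarith

lemma tendsto_nearest {X : Type*} [MetricSpace X] [MeasurableSpace X] [BorelSpace X]
    [TopologicalSpace.SeparableSpace X] [Nonempty X]
    (Q : Measure X) [IsProbabilityMeasure Q] (x0 : X)
    (hQ : Integrable (fun x => dist x x0) Q) :
    (∀ N, Integrable (fun x => dist (SimpleFunc.nearestPt (TopologicalSpace.denseSeq X) N x) x) Q) ∧
    Filter.Tendsto (fun N => ∫ x, dist (SimpleFunc.nearestPt (TopologicalSpace.denseSeq X) N x) x ∂Q)
      Filter.atTop (nhds 0) := by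
  have : SecondCountableTopology X := UniformSpace.secondCountable_of_separable X
  set e := TopologicalSpace.denseSeq X with he
  have hb : ∀ N x, dist (SimpleFunc.nearestPt e N x) x ≤ dist x x0 + dist (e 0) x0 := by
    intro N x
    have h1 := SimpleFunc.edist_nearestPt_le e x (Nat.zero_le N)
    rw [edist_dist, edist_dist, ENNReal.ofReal_le_ofReal_iff dist_nonneg] at h1
    have h2 := dist_triangle_right (e 0) x x0
    linarith
  have hm : ∀ N, AEStronglyMeasurable (fun x => dist (SimpleFunc.nearestPt e N x) x) Q := by
    intro N
    exact ((SimpleFunc.nearestPt e N).measurable.dist measurable_id).aestronglyMeasurable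
  have hbi : Integrable (fun x => dist x x0 + dist (e 0) x0) Q := hQ.add (integrable_const _)
  refine ⟨fun N => hbi.mono' (hm N) ?_, ?_⟩
  · refine Filter.Eventually.of_forall fun x => ?_
    rw [Real.norm_of_nonneg dist_nonneg]
    exact hb N x
  · have h0 : (0 : ℝ) = ∫ x : X, (0 : ℝ) ∂Q := by simp
    rw [h0]
    refine tendsto_integral_of_dominated_convergence _ hm hbi ?_ ?_
    · intro N
      refine Filter.Eventually.of_forall fun x => ?_
      rw [Real.norm_of_nonneg dist_nonneg]
      exact hb N x
    · refine Filter.Eventually.of_forall fun x => ?_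
      rw [← tendsto_iff_dist_tendsto_zero]
      exact SimpleFunc.tendsto_nearestPt ((TopologicalSpace.denseRange_denseSeq X) x)

lemma kr_bound {X : Type*} [MetricSpace X] [MeasurableSpace X] [BorelSpace X]
    [TopologicalSpace.SeparableSpace X]
    (Q P : Measure X) [IsProbabilityMeasure Q] [IsProbabilityMeasure P] (x0 : X)
    (hQ : Integrable (fun x => dist x x0) Q) (hP : Integrable (fun x => dist x x0) P) (B : ℝ)
    (hB : ∀ F : X → ℝ, LipschitzWith 1 F → ∫ x, F x ∂Q - ∫ x, F x ∂P ≤ B) :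
    W1 Q P ≤ B := by
  classical
  have : Nonempty X := ⟨x0⟩
  have : SecondCountableTopology X := UniformSpace.secondCountable_of_separable X
  have hB0 : 0 ≤ B := by
    have := hB (fun _ => 0) (LipschitzWith.const' 0)
    simpa using this
  suffices h : ∀ ε : ℝ, 0 < ε → (⨅ μ ∈ couplings Q P, ∫⁻ p : X × X, edist p.1 p.2 ∂μ) ≤
      ENNReal.ofReal (B + 5 * ε) by
    refine le_of_forall_pos_le_add fun ε hε => ?_
    have h1 := ENNReal.toReal_mono ENNReal.ofReal_ne_top (h (ε / 5) (by positivity))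
    rw [ENNReal.toReal_ofReal (by positivity)] at h1
    unfold W1
    linarith
  intro ε hε
  obtain ⟨hQi, hQt⟩ := tendsto_nearest Q x0 hQ
  obtain ⟨hPi, hPt⟩ := tendsto_nearest P x0 hP
  obtain ⟨N, hN1, hN2⟩ := ((hQt.eventually_lt_const hε).and (hPt.eventually_lt_const hε)).exists
  set r := SimpleFunc.nearestPt (TopologicalSpace.denseSeq X) N with hr
  let T : X → r.range := fun x => ⟨r x, r.mem_range_self x⟩
  have hT : Measurable T := r.measurable.subtype_mk
  have hne : Nonempty r.range := ⟨T x0⟩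
  obtain ⟨π, hπ0, hπ1, hπ2, φ, ψ, hφψ, hval⟩ := fin_dual (fun i => Q.real (T ⁻¹' {i}))
    (fun i => P.real (T ⁻¹' {i})) (fun _ => measureReal_nonneg) (fun _ => measureReal_nonneg)
    (by have := integral_comp_fin Q T hT (fun _ => 1); simpa using this.symm)
    (by have := integral_comp_fin P T hT (fun _ => 1); simpa using this.symm)
    (fun i j => dist (i : X) (j : X)) ε hε
  obtain ⟨μ, hμ, hμg⟩ := coupling_of_fin Q P T hT (fun i j => ENNReal.ofReal (π i j))
    (by
      intro i
      rw [← ENNReal.ofReal_sum_of_nonneg (fun j _ => hπ0 i j), hπ1 i, ofReal_measureReal])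
    (by
      intro j
      rw [← ENNReal.ofReal_sum_of_nonneg (fun i _ => hπ0 i j), hπ2 j, ofReal_measureReal])
  -- the dual potential
  let F : X → ℝ := fun x =>
    Finset.univ.inf' Finset.univ_nonempty (fun j : r.range => dist x (j : X) - ψ j)
  have hF : LipschitzWith 1 F := by
    refine LipschitzWith.of_le_add fun x y => ?_
    rw [← sub_le_iff_le_add]
    refine Finset.le_inf' _ _ fun j _ => ?_
    have h1 : F x ≤ dist x (j : X) - ψ j := Finset.inf'_le _ (Finset.mem_univ j)
    have h2 := dist_triangle x y (j : X)
    linarith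
  have hFQ := lipschitz_integrable Q x0 hQ F hF
  have hFP := lipschitz_integrable P x0 hP F hF
  have hFr : Measurable fun x => F (r x) := hF.continuous.measurable.comp r.measurable
  have hFd : ∀ x, |F (r x) - F x| ≤ dist (r x) x := by
    intro x
    have := hF.dist_le_mul (r x) x
    simpa [Real.dist_eq] using this
  have hFrQ : Integrable (fun x => F (r x)) Q := by
    have := Measure.isProbabilityMeasure_map (μ := Q) hT.aemeasurable
    exact (Integrable.of_finite (μ := Q.map T) (f := fun i => F (i : X))).comp_measurable hT
  have hFrP : Integrable (fun x => F (r x)) P := by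
    have := Measure.isProbabilityMeasure_map (μ := P) hT.aemeasurable
    exact (Integrable.of_finite (μ := P.map T) (f := fun i => F (i : X))).comp_measurable hT
  have i1 : ∑ i, φ i * Q.real (T ⁻¹' {i}) ≤ ∫ x, F x ∂Q + ε := by
    have h1 : ∑ i, φ i * Q.real (T ⁻¹' {i}) ≤ ∫ x, F (r x) ∂Q := by
      have := integral_comp_fin Q T hT (fun i => F (i : X))
      simp only [T] at this
      rw [this]
      refine Finset.sum_le_sum fun i _ => mul_le_mul_of_nonneg_right ?_ measureReal_nonneg
      refine Finset.le_inf' _ _ fun j _ => ?_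
      have := hφψ i j
      linarith
    have h2 : ∫ x, F (r x) ∂Q ≤ ∫ x, (F x + dist (r x) x) ∂Q := by
      refine integral_mono hFrQ (hFQ.add (hQi N)) fun x => ?_
      have := (abs_le.1 (hFd x)).2
      simp only
      linarith
    rw [integral_add hFQ (hQi N)] at h2
    linarith
  have i2 : ∑ j, ψ j * P.real (T ⁻¹' {j}) ≤ -∫ x, F x ∂P + ε := by
    have h1 : ∑ i, ψ i * P.real (T ⁻¹' {i}) ≤ ∫ x, -F (r x) ∂P := by
      have := integral_comp_fin P T hT (fun i => -F (i : X))
      simp only [T] at this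
      rw [this]
      refine Finset.sum_le_sum fun i _ => mul_le_mul_of_nonneg_right ?_ measureReal_nonneg
      have h3 : F (i : X) ≤ dist (i : X) (i : X) - ψ i := Finset.inf'_le _ (Finset.mem_univ i)
      rw [dist_self] at h3
      linarith
    have h2 : ∫ x, -F (r x) ∂P ≤ ∫ x, (-F x + dist (r x) x) ∂P := by
      refine integral_mono hFrP.neg (hFP.neg.add (hPi N)) fun x => ?_
      have := (abs_le.1 (hFd x)).1
      simp only
      linarith
    rw [integral_add (f := fun x => -F x) hFP.neg (hPi N)] at h2
    simp only [integral_neg] at h1 h2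
    linarith
  have i3 := hB F hF
  have i4 : ∑ i, ∑ j, π i j * dist (i : X) (j : X) ≤ B + 3 * ε := by linarith
  refine (iInf₂_le μ hμ).trans ?_
  have hrm := r.measurable
  have hm1 : Measurable fun x => edist (r x) x := hrm.edist measurable_id
  calc ∫⁻ p : X × X, edist p.1 p.2 ∂μ
      ≤ ∫⁻ p : X × X, (edist (r p.1) p.1 + edist (r p.2) p.2) + edist (r p.1) (r p.2) ∂μ := by
        refine lintegral_mono fun p => ?_
        refine (edist_triangle4 p.1 (r p.1) (r p.2) p.2).trans (le_of_eq ?_)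
        rw [edist_comm p.1]
        ring
    _ = (∫⁻ p : X × X, edist (r p.1) p.1 ∂μ + ∫⁻ p : X × X, edist (r p.2) p.2 ∂μ) +
          ∫⁻ p : X × X, edist (r p.1) (r p.2) ∂μ := by
        have hm2 : Measurable fun p : X × X => edist (r p.1) p.1 := hm1.comp measurable_fst
        have hm3 : Measurable fun p : X × X => edist (r p.2) p.2 := hm1.comp measurable_snd
        have hm4 : Measurable fun p : X × X => edist (r p.1) p.1 + edist (r p.2) p.2 :=
          hm2.add hm3
        rw [lintegral_add_left hm4, lintegral_add_left hm2]
    _ ≤ (ENNReal.ofReal ε + ENNReal.ofReal ε) + ENNReal.ofReal (B + 3 * ε) := by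
        gcongr
        · have : ∫⁻ p : X × X, edist (r p.1) p.1 ∂μ = ∫⁻ x, edist (r x) x ∂Q := by
            rw [← hμ.1, lintegral_map hm1 measurable_fst]
          rw [this]
          simp only [edist_dist]
          rw [← ofReal_integral_eq_lintegral_ofReal (hQi N)
            (Filter.Eventually.of_forall fun _ => dist_nonneg)]
          exact ENNReal.ofReal_le_ofReal hN1.le
        · have : ∫⁻ p : X × X, edist (r p.2) p.2 ∂μ = ∫⁻ x, edist (r x) x ∂P := by
            rw [← hμ.2, lintegral_map hm1 measurable_snd]
          rw [this]
          simp only [edist_dist]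
          rw [← ofReal_integral_eq_lintegral_ofReal (hPi N)
            (Filter.Eventually.of_forall fun _ => dist_nonneg)]
          exact ENNReal.ofReal_le_ofReal hN2.le
        · refine (hμg (fun i j => edist (i : X) (j : X))).trans ?_
          refine le_trans (le_of_eq ?_) (ENNReal.ofReal_le_ofReal i4)
          rw [ENNReal.ofReal_sum_of_nonneg (fun i _ => Finset.sum_nonneg fun j _ =>
            mul_nonneg (hπ0 i j) dist_nonneg)]
          refine Finset.sum_congr rfl fun i _ => ?_
          rw [ENNReal.ofReal_sum_of_nonneg (fun j _ => mul_nonneg (hπ0 i j) dist_nonneg)]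
          refine Finset.sum_congr rfl fun j _ => ?_
          rw [ENNReal.ofReal_mul (hπ0 i j), edist_dist]
    _ = ENNReal.ofReal (B + 5 * ε) := by
        rw [← ENNReal.ofReal_add hε.le hε.le, ← ENNReal.ofReal_add (by positivity) (by positivity)]
        congr 1
        ring

lemma exp_dist_integrable {X : Type*} [MetricSpace X] [MeasurableSpace X] [BorelSpace X]
    (P : Measure X) [IsProbabilityMeasure P] (σ : ℝ)
    (hsub : ∀ f : X → ℝ, LipschitzWith 1 f → ∀ lam : ℝ,
      Real.log (∫ w, Real.exp (lam * (f w - ∫ w', f w' ∂P)) ∂P) ≤ lam ^ 2 * σ ^ 2 / 2)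
    (x0 : X) (t : ℝ) (ht : 0 ≤ t) : Integrable (fun x => Real.exp (t * dist x x0)) P := by
  have hdm : Measurable fun x : X => dist x x0 := (continuous_id.dist continuous_const).measurable
  let f : ℕ → X → ℝ := fun R x => min (dist x x0) R
  have hfL : ∀ R, LipschitzWith 1 (f R) := fun R => (LipschitzWith.dist_left x0).min_const _
  have hfm : ∀ R, Measurable (f R) := fun R => (hfL R).continuous.measurable
  have hf0 : ∀ R x, 0 ≤ f R x := fun R x => le_min dist_nonneg (Nat.cast_nonneg R)
  have hfR : ∀ R x, f R x ≤ R := fun R x => min_le_right _ _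
  -- exponential moments of bounded functions
  have hexpI : ∀ R (lam m : ℝ), Integrable (fun x => Real.exp (lam * (f R x - m))) P := by
    intro R lam m
    refine Integrable.of_bound (C := Real.exp (|lam| * (R + |m|))) ?_ ?_
    · exact (((hfm R).sub_const m).const_mul lam).exp.aestronglyMeasurable
    · refine Filter.Eventually.of_forall fun x => ?_
      rw [Real.norm_of_nonneg (Real.exp_pos _).le]
      refine Real.exp_le_exp.2 ((le_abs_self _).trans ?_)
      rw [abs_mul]
      refine mul_le_mul_of_nonneg_left ?_ (abs_nonneg _)
      refine (abs_sub _ _).trans ?_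
      rw [abs_of_nonneg (hf0 R x)]
      linarith [hfR R x]
  have hmgf : ∀ R (lam : ℝ), ∫ x, Real.exp (lam * (f R x - ∫ y, f R y ∂P)) ∂P ≤
      Real.exp (lam ^ 2 * σ ^ 2 / 2) := by
    intro R lam
    have hpos : 0 < ∫ x, Real.exp (lam * (f R x - ∫ y, f R y ∂P)) ∂P :=
      integral_exp_pos (hexpI R lam _)
    exact (Real.log_le_iff_le_exp hpos).1 (hsub (f R) (hfL R) lam)
  -- a ball of positive mass
  obtain ⟨k, hk⟩ : ∃ k : ℕ, P (Metric.closedBall x0 k) ≠ 0 := by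
    by_contra! h
    have h1 : P (⋃ k : ℕ, Metric.closedBall x0 k) = 0 := measure_iUnion_null h
    rw [Metric.iUnion_closedBall_nat] at h1
    simp at h1
  have hk' : 0 < P.real (Metric.closedBall x0 k) := ENNReal.toReal_pos hk (measure_ne_top _ _)
  set p := P.real (Metric.closedBall x0 k) with hp
  -- the means are bounded
  have hmean : ∀ R, ∫ y, f R y ∂P ≤ k + σ ^ 2 / 2 - Real.log p := by
    intro R
    set m := ∫ y, f R y ∂P with hm
    have h1 := hmgf R (-1)
    rw [← hm] at h1
    have h2 : p * Real.exp (m - k) ≤ ∫ x, Real.exp (-1 * (f R x - m)) ∂P := by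
      have h3 : ∫ x in Metric.closedBall x0 k, Real.exp (m - k) ∂P ≤
          ∫ x in Metric.closedBall x0 k, Real.exp (-1 * (f R x - m)) ∂P := by
        refine setIntegral_mono_on (integrable_const _).integrableOn (hexpI R _ _).integrableOn
          Metric.isClosed_closedBall.measurableSet fun x hx => ?_
        refine Real.exp_le_exp.2 ?_
        have : f R x ≤ k := (min_le_left _ _).trans hx
        linarith
      rw [setIntegral_const, smul_eq_mul] at h3
      exact h3.trans (setIntegral_le_integral (hexpI R _ _)
        (Filter.Eventually.of_forall fun _ => (Real.exp_pos _).le))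
    have h4 := Real.log_le_log (by positivity) (h2.trans h1)
    rw [Real.log_mul hk'.ne' (Real.exp_pos _).ne', Real.log_exp, Real.log_exp] at h4
    linarith
  set M := k + σ ^ 2 / 2 - Real.log p with hM
  have hbound : ∀ R, ∫ x, Real.exp (t * f R x) ∂P ≤ Real.exp (t * M + t ^ 2 * σ ^ 2 / 2) := by
    intro R
    have h1 := hmgf R t
    have h2 : ∀ x, Real.exp (t * f R x) =
        Real.exp (t * ∫ y, f R y ∂P) * Real.exp (t * (f R x - ∫ y, f R y ∂P)) := by
      intro x
      rw [← Real.exp_add]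
      congr 1
      ring
    simp only [h2]
    rw [integral_const_mul, Real.exp_add]
    refine mul_le_mul (Real.exp_le_exp.2 (mul_le_mul_of_nonneg_left (hmean R) ht)) h1
      (integral_nonneg fun _ => (Real.exp_pos _).le) (Real.exp_pos _).le
  refine ⟨(hdm.const_mul t).exp.aestronglyMeasurable, ?_⟩
  rw [hasFiniteIntegral_iff_ofReal (Filter.Eventually.of_forall fun _ => (Real.exp_pos _).le)]
  have hlim : ∀ x, Filter.liminf (fun R : ℕ => ENNReal.ofReal (Real.exp (t * f R x))) Filter.atTop =
      ENNReal.ofReal (Real.exp (t * dist x x0)) := by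
    intro x
    refine Filter.Tendsto.liminf_eq (tendsto_const_nhds.congr' ?_)
    obtain ⟨K, hK⟩ := exists_nat_ge (dist x x0)
    filter_upwards [Filter.eventually_ge_atTop K] with R hR
    have : f R x = dist x x0 := min_eq_left (hK.trans (Nat.cast_le.2 hR))
    rw [this]
  simp only [← hlim]
  refine (lintegral_liminf_le fun R => ((hfm R).const_mul t).exp.ennreal_ofReal).trans_lt ?_
  refine lt_of_le_of_lt (b := ENNReal.ofReal (Real.exp (t * M + t ^ 2 * σ ^ 2 / 2))) ?_
    ENNReal.ofReal_lt_top
  refine Filter.liminf_le_of_frequently_le' (Filter.Frequently.of_forall fun R => ?_)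
  have h0 := hexpI R t 0
  simp only [sub_zero] at h0
  rw [← ofReal_integral_eq_lintegral_ofReal h0
    (Filter.Eventually.of_forall fun _ => (Real.exp_pos _).le)]
  exact ENNReal.ofReal_le_ofReal (hbound R)

lemma young_ineq (a b : ℝ) (ha : 0 ≤ a) : a * b ≤ a * Real.log a - a + Real.exp b := by
  rcases ha.eq_or_lt with h | h
  · rw [← h]
    simp [(Real.exp_pos b).le]
  · have h1 := Real.add_one_le_exp (b - Real.log a)
    rw [Real.exp_sub, Real.exp_log h, le_div_iff₀ h] at h1
    linarith

lemma dv_integrable {X : Type*} [MeasurableSpace X] (P Q : Measure X) [IsProbabilityMeasure P]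
    [IsProbabilityMeasure Q] (hac : Q ≪ P)
    (hlog : Integrable (fun w => Real.log ((Q.rnDeriv P w).toReal)) Q)
    (g : X → ℝ) (hg : Measurable g) (he : Integrable (fun x => Real.exp |g x|) P) :
    Integrable g Q := by
  rw [← integrable_rnDeriv_smul_iff hac]
  have h1 := (integrable_rnDeriv_smul_iff (f := fun w => Real.log ((Q.rnDeriv P w).toReal)) hac).2 hlog
  have h2 : Integrable (fun x => (Q.rnDeriv P x).toReal) P := Measure.integrable_toReal_rnDeriv
  refine ((h1.sub h2).add he).mono' ?_ (Filter.Eventually.of_forall fun x => ?_)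
  · exact ((Measure.measurable_rnDeriv Q P).ennreal_toReal.mul hg).aestronglyMeasurable
  · rw [norm_smul, Real.norm_eq_abs, Real.norm_eq_abs, abs_of_nonneg ENNReal.toReal_nonneg]
    exact young_ineq _ _ ENNReal.toReal_nonneg

lemma dv_ineq {X : Type*} [MeasurableSpace X] (P Q : Measure X) [IsProbabilityMeasure P]
    [IsProbabilityMeasure Q] (hac : Q ≪ P)
    (hlog : Integrable (fun w => Real.log ((Q.rnDeriv P w).toReal)) Q)
    (g : X → ℝ) (hg : Integrable g Q) (he : Integrable (fun x => Real.exp (g x)) P) :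
    ∫ x, g x ∂Q ≤ klDiv Q P - 1 + ∫ x, Real.exp (g x) ∂P := by
  have h1 := (integrable_rnDeriv_smul_iff (f := fun w => Real.log ((Q.rnDeriv P w).toReal)) hac).2 hlog
  have h2 : Integrable (fun x => (Q.rnDeriv P x).toReal) P := Measure.integrable_toReal_rnDeriv
  have h3 := (integrable_rnDeriv_smul_iff hac).2 hg
  have h4 : ∫ x, (Q.rnDeriv P x).toReal • g x ∂P ≤
      ∫ x, ((Q.rnDeriv P x).toReal • Real.log ((Q.rnDeriv P x).toReal) - (Q.rnDeriv P x).toReal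
        + Real.exp (g x)) ∂P := by
    refine integral_mono h3 ((h1.sub h2).add he) fun x => ?_
    exact young_ineq _ _ ENNReal.toReal_nonneg
  have h12 : Integrable (fun x => (Q.rnDeriv P x).toReal • Real.log ((Q.rnDeriv P x).toReal)
      - (Q.rnDeriv P x).toReal) P := h1.sub h2
  rw [integral_add h12 he, integral_sub h1 h2, integral_rnDeriv_smul hac,
    integral_rnDeriv_smul hac, Measure.integral_toReal_rnDeriv hac] at h4
  simpa [klDiv] using h4

lemma kl_nonneg {X : Type*} [MeasurableSpace X] (P Q : Measure X) [IsProbabilityMeasure P]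
    [IsProbabilityMeasure Q] (hac : Q ≪ P)
    (hlog : Integrable (fun w => Real.log ((Q.rnDeriv P w).toReal)) Q) : 0 ≤ klDiv Q P := by
  have := dv_ineq P Q hac hlog (fun _ => 0) (integrable_zero _ _ _) (by simp)
  simpa using this

lemma dv_subgaussian {X : Type*} [MeasurableSpace X] (P Q : Measure X) [IsProbabilityMeasure P]
    [IsProbabilityMeasure Q] (hac : Q ≪ P)
    (hlog : Integrable (fun w => Real.log ((Q.rnDeriv P w).toReal)) Q)
    (σ : ℝ) (hσ : 0 < σ) (g : X → ℝ) (hg : Integrable g Q)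
    (he : ∀ t, Integrable (fun x => Real.exp (t * g x)) P)
    (hsub : ∀ lam : ℝ, Real.log (∫ w, Real.exp (lam * (g w - ∫ w', g w' ∂P)) ∂P) ≤
      lam ^ 2 * σ ^ 2 / 2) :
    |∫ x, g x ∂Q - ∫ x, g x ∂P| ≤ Real.sqrt (2 * σ ^ 2 * klDiv Q P) := by
  set m := ∫ x, g x ∂P with hm
  have key : ∀ lam : ℝ, lam * (∫ x, g x ∂Q - m) - lam ^ 2 * σ ^ 2 / 2 ≤ klDiv Q P := by
    intro lam
    have he1 : Integrable (fun x => Real.exp (lam * (g x - m))) P := by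
      have : ∀ x, Real.exp (lam * (g x - m)) = Real.exp (-(lam * m)) * Real.exp (lam * g x) := by
        intro x
        rw [← Real.exp_add]
        congr 1
        ring
      simp only [this]
      exact (he lam).const_mul _
    have hpos : 0 < ∫ x, Real.exp (lam * (g x - m)) ∂P := integral_exp_pos he1
    have h1 := (Real.log_le_iff_le_exp hpos).1 (hsub lam)
    set c := lam ^ 2 * σ ^ 2 / 2 with hc
    have he2 : ∀ x, Real.exp (lam * (g x - m) - c) =
        Real.exp (-c) * Real.exp (lam * (g x - m)) := by
      intro x
      rw [← Real.exp_add]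
      congr 1
      ring
    have hgi : Integrable (fun x => lam * (g x - m)) Q := (hg.sub (integrable_const m)).const_mul lam
    have h2 := dv_ineq P Q hac hlog (fun x => lam * (g x - m) - c) (hgi.sub (integrable_const c))
      (by simp only [he2]; exact he1.const_mul _)
    simp only [he2] at h2
    rw [integral_const_mul, integral_sub hgi (integrable_const c), integral_const_mul,
      integral_sub hg (integrable_const m)] at h2
    simp only [integral_const, probReal_univ, one_smul] at h2
    have h3 : Real.exp (-c) * ∫ x, Real.exp (lam * (g x - m)) ∂P ≤ 1 := by
      have := mul_le_mul_of_nonneg_left h1 (Real.exp_pos (-c)).le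
      rwa [← Real.exp_add, neg_add_cancel, Real.exp_zero] at this
    linarith
  refine Real.abs_le_sqrt ?_
  have h := key ((∫ x, g x ∂Q - m) / σ ^ 2)
  set D := ∫ x, g x ∂Q - m with hD
  have h5 : D / σ ^ 2 * D - (D / σ ^ 2) ^ 2 * σ ^ 2 / 2 = D ^ 2 / (2 * σ ^ 2) := by
    field_simp
    ring
  rw [h5, div_le_iff₀ (by positivity)] at h
  linarith

lemma exp_lip_integrable {X : Type*} [MetricSpace X] [MeasurableSpace X] [BorelSpace X]
    (P : Measure X) [IsProbabilityMeasure P] (x0 : X)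
    (hP : ∀ t : ℝ, 0 ≤ t → Integrable (fun x => Real.exp (t * dist x x0)) P)
    (f : X → ℝ) (hfm : Measurable f) (K : ℝ) (hf : ∀ x y, |f x - f y| ≤ K * dist x y) (t : ℝ) :
    Integrable (fun x => Real.exp |t * f x|) P := by
  refine ((hP (|t| * |K|) (by positivity)).const_mul (Real.exp (|t| * |f x0|))).mono' ?_
    (Filter.Eventually.of_forall fun x => ?_)
  · have : Measurable fun x => |t * f x| := (hfm.const_mul t).norm
    exact this.exp.aestronglyMeasurable
  · rw [Real.norm_of_nonneg (Real.exp_pos _).le, ← Real.exp_add]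
    refine Real.exp_le_exp.2 ?_
    rw [abs_mul, mul_assoc, ← mul_add]
    refine mul_le_mul_of_nonneg_left ?_ (abs_nonneg t)
    have h1 := hf x x0
    have h2 := abs_add_le (f x - f x0) (f x0)
    rw [sub_add_cancel] at h2
    have h3 := mul_le_mul_of_nonneg_right (le_abs_self K) (dist_nonneg (x := x) (y := x0))
    linarith

lemma lip_subgaussian_bound {X : Type*} [MetricSpace X] [MeasurableSpace X] [BorelSpace X]
    (P Q : Measure X) [IsProbabilityMeasure P] [IsProbabilityMeasure Q] (hac : Q ≪ P)
    (hlog : Integrable (fun w => Real.log ((Q.rnDeriv P w).toReal)) Q)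
    (σ : ℝ) (hσ : 0 < σ) (x0 : X)
    (hP : ∀ t : ℝ, 0 ≤ t → Integrable (fun x => Real.exp (t * dist x x0)) P)
    (f : X → ℝ) (hfm : Measurable f) (K : ℝ) (hf : ∀ x y, |f x - f y| ≤ K * dist x y)
    (hsub : ∀ lam : ℝ, Real.log (∫ w, Real.exp (lam * (f w - ∫ w', f w' ∂P)) ∂P) ≤
      lam ^ 2 * σ ^ 2 / 2) :
    Integrable f Q ∧ |∫ x, f x ∂Q - ∫ x, f x ∂P| ≤ Real.sqrt (2 * σ ^ 2 * klDiv Q P) := by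
  have h1 := exp_lip_integrable P x0 hP f hfm K hf
  have h2 : Integrable f Q := dv_integrable P Q hac hlog f hfm (by simpa using h1 1)
  refine ⟨h2, dv_subgaussian P Q hac hlog σ hσ f h2 (fun t => ?_) hsub⟩
  refine (h1 t).mono' (hfm.const_mul t).exp.aestronglyMeasurable
    (Filter.Eventually.of_forall fun x => ?_)
  rw [Real.norm_of_nonneg (Real.exp_pos _).le]
  exact Real.exp_le_exp.2 (le_abs_self _)

lemma transport_bound {X : Type*} [MetricSpace X] [MeasurableSpace X] [BorelSpace X]
    [TopologicalSpace.SeparableSpace X]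
    (P Q : Measure X) [IsProbabilityMeasure P] [IsProbabilityMeasure Q] (hac : Q ≪ P)
    (hlog : Integrable (fun w => Real.log ((Q.rnDeriv P w).toReal)) Q)
    (σ : ℝ) (hσ : 0 < σ)
    (hsub : ∀ f : X → ℝ, LipschitzWith 1 f → ∀ lam : ℝ,
      Real.log (∫ w, Real.exp (lam * (f w - ∫ w', f w' ∂P)) ∂P) ≤ lam ^ 2 * σ ^ 2 / 2) :
    W1 Q P ≤ Real.sqrt (2 * σ ^ 2 * klDiv Q P) := by
  obtain ⟨x0⟩ : Nonempty X := nonempty_of_isProbabilityMeasure P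
  have hP := exp_dist_integrable P σ hsub x0
  have hlip : ∀ F : X → ℝ, LipschitzWith 1 F → ∀ x y, |F x - F y| ≤ 1 * dist x y := by
    intro F hF x y
    have := hF.dist_le_mul x y
    simpa [Real.dist_eq] using this
  have hd : LipschitzWith 1 (fun x : X => dist x x0) := LipschitzWith.dist_left x0
  have hdP : Integrable (fun x => dist x x0) P := by
    refine (hP 1 zero_le_one).mono' hd.continuous.measurable.aestronglyMeasurable
      (Filter.Eventually.of_forall fun x => ?_)
    rw [Real.norm_of_nonneg dist_nonneg, one_mul]
    linarith [Real.add_one_le_exp (dist x x0)]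
  have hb := fun (F : X → ℝ) (hF : LipschitzWith 1 F) => lip_subgaussian_bound P Q hac hlog σ hσ x0
    hP F hF.continuous.measurable 1 (hlip F hF) (hsub F hF)
  exact kr_bound Q P x0 (hb _ hd).1 hdP _ fun F hF => (le_abs_self _).trans (hb F hF).2

lemma integral_bind_kernel {α β : Type*} [MeasurableSpace α] [MeasurableSpace β]
    (μ : Measure α) [SFinite μ] (κ : Kernel α β) [IsSFiniteKernel κ] (f : β → ℝ)
    (hf : Integrable f (μ.bind κ)) : ∫ y, f y ∂(μ.bind κ) = ∫ x, ∫ y, f y ∂(κ x) ∂μ := by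
  rw [Measure.comp_eq_comp_const_apply] at hf ⊢
  rw [Kernel.integral_comp hf, Kernel.const_apply]

lemma measurable_update_pair {Z : Type*} [MeasurableSpace Z] {n : ℕ} (i : Fin n) :
    Measurable fun p : Z × (Fin n → Z) => Function.update p.2 i p.1 := by
  refine measurable_pi_lambda _ fun j => ?_
  by_cases h : j = i
  · subst h
    simpa using measurable_fst
  · simp only [Function.update_of_ne h]
    exact (measurable_pi_apply j).comp measurable_snd

lemma mp_update {Z : Type*} [MeasurableSpace Z] (PZ : Measure Z) [IsProbabilityMeasure PZ] {n : ℕ}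
    (i : Fin n) : MeasurePreserving (fun p : Z × (Fin n → Z) => Function.update p.2 i p.1)
      (PZ.prod (Pn PZ n)) (Pn PZ n) := by
  refine ⟨measurable_update_pair i, ?_⟩
  unfold Pn
  symm
  refine Measure.pi_eq fun s hs => ?_
  rw [Measure.map_apply (measurable_update_pair i) (MeasurableSet.univ_pi hs)]
  have : (fun p : Z × (Fin n → Z) => Function.update p.2 i p.1) ⁻¹' (Set.univ.pi s) =
      s i ×ˢ (Set.univ.pi (Function.update s i Set.univ)) := by
    ext ⟨z, x⟩
    simp only [Set.mem_preimage, Set.mem_pi, Set.mem_univ, true_imp_iff, Set.mem_prod]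
    constructor
    · intro h
      refine ⟨by simpa using h i, fun j => ?_⟩
      by_cases hj : j = i
      · subst hj
        simp
      · simpa [Function.update_of_ne hj] using h j
    · rintro ⟨h1, h2⟩ j
      by_cases hj : j = i
      · subst hj
        simpa using h1
      · simpa [Function.update_of_ne hj] using h2 j
  rw [this, Measure.prod_prod, Measure.pi_pi]
  rw [← Finset.mul_prod_erase Finset.univ (fun j => PZ (s j)) (Finset.mem_univ i),
    ← Finset.mul_prod_erase Finset.univ (fun j => PZ (Function.update s i Set.univ j))
      (Finset.mem_univ i)]
  simp only [Function.update_self, measure_univ, one_mul]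
  congr 1
  refine Finset.prod_congr rfl fun j hj => ?_
  rw [Function.update_of_ne (Finset.ne_of_mem_erase hj)]

instance isProb_Pn {Z : Type*} [MeasurableSpace Z] (PZ : Measure Z) [IsProbabilityMeasure PZ]
    (n : ℕ) : IsProbabilityMeasure (Pn PZ n) := by
  unfold Pn
  infer_instance

lemma hypLaw_eq {Z W : Type*} [MeasurableSpace Z] [MeasurableSpace W] (PZ : Measure Z) {n : ℕ}
    (A : Kernel (Fin n → Z) W) : hypLaw PZ A = (Pn PZ n).bind A := rfl

lemma measurable_update_fix {Z : Type*} [MeasurableSpace Z] {n : ℕ} (i : Fin n) (z : Z) :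
    Measurable fun s : Fin n → Z => Function.update s i z :=
  (measurable_update_pair i).comp (measurable_const.prodMk measurable_id)

lemma condLaw_eq {Z W : Type*} [MeasurableSpace Z] [MeasurableSpace W] (PZ : Measure Z) {n : ℕ}
    (A : Kernel (Fin n → Z) W) (i : Fin n) (z : Z) : condLaw PZ A i z =
      (Pn PZ n).bind (A.comap (fun s => Function.update s i z) (measurable_update_fix i z)) := rfl

instance isProb_hypLaw {Z W : Type*} [MeasurableSpace Z] [MeasurableSpace W] (PZ : Measure Z)
    [IsProbabilityMeasure PZ] {n : ℕ} (A : Kernel (Fin n → Z) W) [IsMarkovKernel A] :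
    IsProbabilityMeasure (hypLaw PZ A) := by
  rw [hypLaw_eq]
  infer_instance

instance isProb_condLaw {Z W : Type*} [MeasurableSpace Z] [MeasurableSpace W] (PZ : Measure Z)
    [IsProbabilityMeasure PZ] {n : ℕ} (A : Kernel (Fin n → Z) W) [IsMarkovKernel A]
    (i : Fin n) (z : Z) : IsProbabilityMeasure (condLaw PZ A i z) := by
  rw [condLaw_eq]
  infer_instance

lemma integral_sqrt_le {Z : Type*} [MeasurableSpace Z] (PZ : Measure Z) [IsProbabilityMeasure PZ]
    (k : Z → ℝ) (hk0 : ∀ z, 0 ≤ k z) (hk : Integrable k PZ) :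
    Integrable (fun z => Real.sqrt (k z)) PZ ∧
      ∫ z, Real.sqrt (k z) ∂PZ ≤ Real.sqrt (∫ z, k z ∂PZ) := by
  have h1 : Integrable (fun z => Real.sqrt (k z)) PZ := by
    refine (hk.add (integrable_const 1)).mono'
      (Real.continuous_sqrt.comp_aestronglyMeasurable hk.1)
      (Filter.Eventually.of_forall fun z => ?_)
    rw [Real.norm_of_nonneg (Real.sqrt_nonneg _)]
    simp only [Pi.add_apply]
    have := Real.sq_sqrt (hk0 z)
    nlinarith [sq_nonneg (Real.sqrt (k z) - 1), Real.sqrt_nonneg (k z)]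
  refine ⟨h1, ?_⟩
  exact Real.strictConcaveOn_sqrt.concaveOn.le_map_integral Real.continuous_sqrt.continuousOn
    isClosed_Ici (Filter.Eventually.of_forall fun z => hk0 z) hk h1

/-- Bobkov–Götze and its generalization consequence: if every 1-Lipschitz
function is `σ`-subgaussian under `P_W`, then `W₁(Q, P_W) ≤ sqrt(2σ² KL(Q ‖ P_W))` for
every probability measure `Q`; consequently, for a loss that is `L`-Lipschitz and
`σ`-subgaussian under `P_W` for every `z`, the single-letter Wasserstein bound yields
`|E[gen(W,S)]| ≤ (1/n) Σᵢ sqrt(2σ² I(W;Zᵢ))` after Jensen's inequality. -/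
theorem bobkov_goetze_transport_and_gen_bound
    [MetricSpace W] [PolishSpace W] [BorelSpace W]
    (n : ℕ) (hn : 0 < n) (PZ : Measure Z) [IsProbabilityMeasure PZ]
    (A : Kernel (Fin n → Z) W) [IsMarkovKernel A]
    (σ : ℝ) (hσ : 0 < σ)
    (hsub : ∀ f : W → ℝ, LipschitzWith 1 f → ∀ lam : ℝ,
      Real.log (∫ w, Real.exp (lam * (f w - ∫ w', f w' ∂(hypLaw PZ A))) ∂(hypLaw PZ A)) ≤
        lam ^ 2 * σ ^ 2 / 2)
    (ℓ : W → Z → ℝ) (L : ℝ)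
    (hmeas : Measurable fun p : W × Z => ℓ p.1 p.2)
    (hLip : ∀ (z : Z) (w w' : W), |ℓ w z - ℓ w' z| ≤ L * dist w w')
    (hsubℓ : ∀ (z : Z) (lam : ℝ),
      Real.log (∫ w, Real.exp
          (lam * (ℓ w z - ∫ w', ℓ w' z ∂(hypLaw PZ A))) ∂(hypLaw PZ A)) ≤
        lam ^ 2 * σ ^ 2 / 2)
    (hint1 : ∀ w : W, Integrable (fun z => ℓ w z) PZ)
    (hint2 : Integrable (fun s => ∫ w, gen PZ ℓ w s ∂(A s)) (Pn PZ n))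
    (hac : ∀ (i : Fin n) (z : Z), condLaw PZ A i z ≪ hypLaw PZ A)
    (hintlog : ∀ (i : Fin n) (z : Z),
      Integrable (fun w => Real.log (((condLaw PZ A i z).rnDeriv (hypLaw PZ A) w).toReal))
        (condLaw PZ A i z))
    (hintKL : ∀ i : Fin n,
      Integrable (fun z => klDiv (condLaw PZ A i z) (hypLaw PZ A)) PZ) :
    (∀ Q : Measure W, IsProbabilityMeasure Q → Q ≪ hypLaw PZ A →
      Integrable (fun w => Real.log ((Q.rnDeriv (hypLaw PZ A) w).toReal)) Q →
      W1 Q (hypLaw PZ A) ≤ Real.sqrt (2 * σ ^ 2 * klDiv Q (hypLaw PZ A))) ∧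
    |expGen PZ A ℓ| ≤
      (1 / (n : ℝ)) * ∑ i : Fin n,
        Real.sqrt (2 * σ ^ 2 * ∫ z, klDiv (condLaw PZ A i z) (hypLaw PZ A) ∂PZ) := by
  have hP := exp_dist_integrable (hypLaw PZ A) σ hsub
  have hfirst : ∀ Q : Measure W, IsProbabilityMeasure Q → Q ≪ hypLaw PZ A →
      Integrable (fun w => Real.log ((Q.rnDeriv (hypLaw PZ A) w).toReal)) Q →
      W1 Q (hypLaw PZ A) ≤ Real.sqrt (2 * σ ^ 2 * klDiv Q (hypLaw PZ A)) := by
    intro Q hQ hQac hQlog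
    exact transport_bound (hypLaw PZ A) Q hQac hQlog σ hσ hsub
  refine ⟨hfirst, ?_⟩
  obtain ⟨x0⟩ : Nonempty W := nonempty_of_isProbabilityMeasure (hypLaw PZ A)
  replace hP := hP x0
  set P := hypLaw PZ A with hPdef
  have hdm : Measurable fun x : W => dist x x0 := (continuous_id.dist continuous_const).measurable
  have hdP : Integrable (fun x => dist x x0) P := by
    refine (hP 1 zero_le_one).mono' hdm.aestronglyMeasurable
      (Filter.Eventually.of_forall fun x => ?_)
    rw [Real.norm_of_nonneg dist_nonneg, one_mul]
    linarith [Real.add_one_le_exp (dist x x0)]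
  have hℓz : ∀ z, Measurable fun w => ℓ w z := fun z =>
    hmeas.comp (measurable_id.prodMk measurable_const)
  have hℓb : ∀ w z, |ℓ w z| ≤ |ℓ x0 z| + L * dist w x0 := by
    intro w z
    have h1 := hLip z w x0
    have h2 := abs_add_le (ℓ w z - ℓ x0 z) (ℓ x0 z)
    rw [sub_add_cancel] at h2
    linarith
  -- integrability on the product of the marginals
  have hprod : Integrable (fun p : W × Z => ℓ p.1 p.2) (P.prod PZ) := by
    refine (((hint1 x0).abs.comp_snd P).add ((hdP.const_mul L).comp_fst PZ)).mono'
      hmeas.aestronglyMeasurable (Filter.Eventually.of_forall fun p => ?_)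
    rw [Real.norm_eq_abs]
    exact hℓb p.1 p.2
  -- integrability on the joint law
  have hJsnd : ((Pn PZ n) ⊗ₘ A).map Prod.snd = P := Measure.snd_compProd (Pn PZ n) A
  have hJfst : ((Pn PZ n) ⊗ₘ A).map Prod.fst = Pn PZ n := Measure.fst_compProd (Pn PZ n) A
  set J := (Pn PZ n) ⊗ₘ A with hJ
  have hJs : ∀ f : W → ℝ, Integrable f P → Integrable (fun p : (Fin n → Z) × W => f p.2) J := by
    intro f hf
    rw [← hJsnd] at hf
    exact hf.comp_measurable measurable_snd
  have hJf : ∀ f : (Fin n → Z) → ℝ, Integrable f (Pn PZ n) →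
      Integrable (fun p : (Fin n → Z) × W => f p.1) J := by
    intro f hf
    rw [← hJfst] at hf
    exact hf.comp_measurable measurable_fst
  have hev : ∀ i : Fin n, MeasurePreserving (fun s : Fin n → Z => s i) (Pn PZ n) PZ :=
    fun i => measurePreserving_eval (fun _ => PZ) i
  have hℓJm : ∀ i : Fin n, Measurable fun p : (Fin n → Z) × W => ℓ p.2 (p.1 i) := fun i =>
    hmeas.comp (measurable_snd.prodMk ((measurable_pi_apply i).comp measurable_fst))
  have hℓJ : ∀ i : Fin n, Integrable (fun p : (Fin n → Z) × W => ℓ p.2 (p.1 i)) J := by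
    intro i
    have h1 : Integrable (fun s : Fin n → Z => |ℓ x0 (s i)|) (Pn PZ n) :=
      (hev i).integrable_comp_of_integrable (hint1 x0).abs
    refine ((hJf _ h1).add (hJs _ (hdP.const_mul L))).mono' (hℓJm i).aestronglyMeasurable
      (Filter.Eventually.of_forall fun p => ?_)
    rw [Real.norm_eq_abs]
    exact hℓb p.2 (p.1 i)
  have hbarP : Integrable (fun w => ∫ z, ℓ w z ∂PZ) P := hprod.integral_prod_left
  have hgen : expGen PZ A ℓ = (1 / (n : ℝ)) *
      ∑ i : Fin n, (∫ w, ∫ z, ℓ w z ∂PZ ∂P - ∫ p, ℓ p.2 (p.1 i) ∂J) := by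
    have hgi : Integrable (fun p : (Fin n → Z) × W => gen PZ ℓ p.2 p.1) J :=
      (hJs _ hbarP).sub ((integrable_finset_sum _ fun i _ => hℓJ i).const_mul _)
    have h1 : expGen PZ A ℓ = ∫ p, gen PZ ℓ p.2 p.1 ∂J := by
      rw [hJ, Measure.integral_compProd hgi]
      rfl
    have h2 : ∫ w, ∫ z, ℓ w z ∂PZ ∂P = ∫ p : (Fin n → Z) × W, ∫ z, ℓ p.2 z ∂PZ ∂J := by
      have h3 := hbarP.aestronglyMeasurable
      rw [← hJsnd] at h3 ⊢
      exact integral_map measurable_snd.aemeasurable h3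
    rw [h1]
    unfold gen
    rw [integral_sub (hJs _ hbarP) ((integrable_finset_sum _ fun i _ => hℓJ i).const_mul _),
      integral_const_mul, integral_finset_sum _ (fun i _ => hℓJ i), Finset.sum_sub_distrib, ← h2]
    have hn' : (n : ℝ) ≠ 0 := by positivity
    simp only [Finset.sum_const, Finset.card_univ, Fintype.card_fin, nsmul_eq_mul]
    field_simp
  have hkl0 : ∀ i z, 0 ≤ klDiv (condLaw PZ A i z) P := fun i z =>
    kl_nonneg P _ (hac i z) (hintlog i z)
  have hcond : ∀ i z, Integrable (fun w => ℓ w z) (condLaw PZ A i z) ∧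
      |∫ w, ℓ w z ∂(condLaw PZ A i z) - ∫ w, ℓ w z ∂P| ≤
        Real.sqrt (2 * σ ^ 2 * klDiv (condLaw PZ A i z) P) := fun i z =>
    lip_subgaussian_bound P _ (hac i z) (hintlog i z) σ hσ x0 hP (fun w => ℓ w z) (hℓz z) L
      (hLip z) (hsubℓ z)
  have hterm : ∀ i : Fin n, |∫ w, ∫ z, ℓ w z ∂PZ ∂P - ∫ p, ℓ p.2 (p.1 i) ∂J| ≤
      Real.sqrt (2 * σ ^ 2 * ∫ z, klDiv (condLaw PZ A i z) P ∂PZ) := by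
    intro i
    have e1 : ∫ w, ∫ z, ℓ w z ∂PZ ∂P = ∫ z, ∫ w, ℓ w z ∂P ∂PZ := integral_integral_swap hprod
    have i1 : Integrable (fun z => ∫ w, ℓ w z ∂P) PZ := hprod.integral_prod_right
    let h : (Fin n → Z) → ℝ := fun s => ∫ w, ℓ w (s i) ∂(A s)
    have hhi : Integrable h (Pn PZ n) := by
      have := (hℓJ i).integral_compProd
      simpa using this
    have e2 : ∫ p, ℓ p.2 (p.1 i) ∂J = ∫ s, h s ∂(Pn PZ n) := by
      rw [hJ, Measure.integral_compProd (hℓJ i)]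
    have hmp := mp_update PZ (n := n) i
    have hhU : Integrable (fun p : Z × (Fin n → Z) => h (Function.update p.2 i p.1))
        (PZ.prod (Pn PZ n)) := hmp.integrable_comp_of_integrable hhi
    have e3 : ∫ s, h s ∂(Pn PZ n) =
        ∫ p : Z × (Fin n → Z), h (Function.update p.2 i p.1) ∂(PZ.prod (Pn PZ n)) := by
      have h3 := hhi.aestronglyMeasurable
      conv_lhs => rw [← hmp.map_eq]
      rw [← hmp.map_eq] at h3
      exact integral_map hmp.measurable.aemeasurable h3
    have e4 : ∀ z, ∫ s, h (Function.update s i z) ∂(Pn PZ n) = ∫ w, ℓ w z ∂(condLaw PZ A i z) := by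
      intro z
      have h5 := (hcond i z).1
      rw [condLaw_eq] at h5 ⊢
      rw [integral_bind_kernel _ _ _ h5]
      simp only [h, Function.update_self, Kernel.comap_apply]
    have i2 : Integrable (fun z => ∫ w, ℓ w z ∂(condLaw PZ A i z)) PZ := by
      simp only [← e4]
      exact hhU.integral_prod_left
    have e5 : ∫ p, ℓ p.2 (p.1 i) ∂J = ∫ z, ∫ w, ℓ w z ∂(condLaw PZ A i z) ∂PZ := by
      rw [e2, e3, integral_prod _ hhU]
      simp only [e4]
    rw [e1, e5, ← integral_sub i1 i2]
    obtain ⟨j1, j2⟩ := integral_sqrt_le PZ (fun z => 2 * σ ^ 2 * klDiv (condLaw PZ A i z) P)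
      (fun z => mul_nonneg (by positivity) (hkl0 i z)) ((hintKL i).const_mul _)
    rw [integral_const_mul] at j2
    refine le_trans ?_ j2
    rw [← Real.norm_eq_abs]
    refine norm_integral_le_of_norm_le j1 (Filter.Eventually.of_forall fun z => ?_)
    rw [Real.norm_eq_abs, abs_sub_comm]
    exact (hcond i z).2
  rw [hgen, abs_mul, abs_of_nonneg (by positivity : (0 : ℝ) ≤ 1 / n)]
  refine mul_le_mul_of_nonneg_left ?_ (by positivity)
  exact (Finset.abs_sum_le_sum_abs _ _).trans (Finset.sum_le_sum fun i _ => hterm i)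

end
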